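/- Let X be a coloured random graph with colour law μ : 𝒳 → (0,1] and connection probabilities p_n satisfying a_n^{-1}·p_n(a,b) → C(a,b) for all a,b ∈ 𝒳, for some symmetric C : 𝒳×𝒳 → [0,∞) and a sequence (a_n) with a_n → 0 and n·a_n → ∞. Then for every open set O ⊂ ℳ(𝒳)×ℳ̃_*(𝒳×𝒳), liminf_{n→∞} (1/(a_n·n²))·log ℙ{ (L¹, L²) ∈ O } ≥ −inf_{(ω,ϖ)∈O} I₁(ω,ϖ), where I₁(ω,ϖ) = (1/2)·𝔥_C(ϖ‖ω). -/

import Mathlib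

open Filter
open scoped ENNReal

noncomputable section

namespace CRG

variable {𝒳 : Type} [Fintype 𝒳] [DecidableEq 𝒳]

/-- The set `ℰ` of formally ordered potential edges on `{1,…,n}`. -/
abbrev Edges (n : ℕ) : Finset (Fin n × Fin n) :=
  Finset.univ.filter (fun e : Fin n × Fin n => e.1 < e.2)

/-- The probability weight `P_n(x)` of a coloured graph `x` (colouring, edge set) under the
coloured random graph law with colour law `μ` and connection probabilities `p`. -/
def graphWeight (μ : 𝒳 → ℝ) (p : 𝒳 → 𝒳 → ℝ) (n : ℕ)
    (x : (Fin n → 𝒳) × Finset (Fin n × Fin n)) : ℝ :=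
  (if x.2 ⊆ Edges n then 1 else 0) *
  (∏ v, μ (x.1 v)) *
  ∏ e ∈ Edges n, (if e ∈ x.2 then p (x.1 e.1) (x.1 e.2) else 1 - p (x.1 e.1) (x.1 e.2))

/-- The probability `ℙ_n(S)` of an event `S` under the coloured random graph law. -/
def graphPr (μ : 𝒳 → ℝ) (p : 𝒳 → 𝒳 → ℝ) (n : ℕ)
    (S : Set ((Fin n → 𝒳) × Finset (Fin n × Fin n))) : ℝ :=
  ∑ x, S.indicator (graphWeight μ p n) x

/-- The empirical colour measure `L¹`. -/
def L1 (n : ℕ) (x : (Fin n → 𝒳) × Finset (Fin n × Fin n)) (a : 𝒳) : ℝ :=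
  ((Finset.univ.filter (fun v : Fin n => x.1 v = a)).card : ℝ) / n

/-- The empirical pair measure `L²` (scaled by `1/(n² aₙ)`). -/
def L2 (an : ℝ) (n : ℕ) (x : (Fin n → 𝒳) × Finset (Fin n × Fin n)) (q : 𝒳 × 𝒳) : ℝ :=
  (∑ e ∈ x.2, ((if (x.1 e.1, x.1 e.2) = q then (1:ℝ) else 0)
    + (if (x.1 e.2, x.1 e.1) = q then (1:ℝ) else 0))) / ((n:ℝ)^2 * an)

/-- Extended-real logarithm, `log 0 = -∞`. -/
def elog (x : ℝ) : EReal := if x ≤ 0 then ⊥ else ((Real.log x : ℝ) : EReal)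

/-- `ℳ(𝒳) × ℳ̃_*(𝒳×𝒳)`: probability vectors paired with finite symmetric measures,
viewed inside `ℝ^𝒳 × ℝ^(𝒳×𝒳)`. -/
def MSpace (𝒳 : Type) [Fintype 𝒳] : Set ((𝒳 → ℝ) × (𝒳 × 𝒳 → ℝ)) :=
  {z | (∀ a, 0 ≤ z.1 a) ∧ (∑ a, z.1 a) = 1 ∧ (∀ q, 0 ≤ z.2 q) ∧ ∀ a b, z.2 (a,b) = z.2 (b,a)}

open Classical in
/-- Relative entropy `H(ν‖ρ)` of measures on a finite set, `+∞` if `ν` is not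
absolutely continuous w.r.t. `ρ`. -/
def relEnt (ν ρ : 𝒳 → ℝ) : ℝ≥0∞ :=
  if ∀ x, ρ x = 0 → ν x = 0 then
    ENNReal.ofReal (∑ x, ν x * Real.log (ν x / ρ x)) else ⊤

open Classical in
/-- `𝔥_C(ϖ‖ω) = H(ϖ‖Cω⊗ω) + ‖Cω⊗ω‖ − ‖ϖ‖`. -/
def hRel (C : 𝒳 → 𝒳 → ℝ) (ω : 𝒳 → ℝ) (ϖ : 𝒳 × 𝒳 → ℝ) : ℝ≥0∞ :=
  if ∀ q : 𝒳 × 𝒳, C q.1 q.2 * ω q.1 * ω q.2 = 0 → ϖ q = 0 then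
    ENNReal.ofReal ((∑ q : 𝒳 × 𝒳, ϖ q * Real.log (ϖ q / (C q.1 q.2 * ω q.1 * ω q.2)))
      + (∑ q : 𝒳 × 𝒳, C q.1 q.2 * ω q.1 * ω q.2) - ∑ q : 𝒳 × 𝒳, ϖ q)
  else ⊤

end CRG

open CRG

/-- The rate function `I₁(ω,ϖ) = ½ 𝔥_C(ϖ‖ω)`. -/
def I1 {𝒳 : Type} [Fintype 𝒳] (C : 𝒳 → 𝒳 → ℝ) (z : (𝒳 → ℝ) × (𝒳 × 𝒳 → ℝ)) : ℝ≥0∞ :=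
  (1/2 : ℝ≥0∞) * hRel C z.1 z.2

namespace CRG

section Asymptotics

theorem factorial_mul_exp_le (k : ℕ) :
    (k.factorial : ℝ) * Real.exp k ≤ ((k : ℝ) + 1) ^ (k + 1) := by
  induction k with
  | zero => simp
  | succ k ih =>
    have hk : (0 : ℝ) < (k : ℝ) + 1 := by positivity
    have hlog : 1 / ((k : ℝ) + 2) ≤ Real.log (((k : ℝ) + 2) / (k + 1)) := by
      have h := Real.one_sub_inv_le_log_of_pos (x := ((k : ℝ) + 2) / (k + 1)) (by positivity)
      refine le_trans (le_of_eq ?_) h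
      field_simp
      ring
    have hexp : Real.exp 1 ≤ (((k : ℝ) + 2) / (k + 1)) ^ (k + 2) := by
      rw [← Real.exp_log (show (0 : ℝ) < (((k : ℝ) + 2) / (k + 1)) ^ (k + 2) by positivity)]
      apply Real.exp_le_exp.2
      rw [Real.log_pow]
      calc (1 : ℝ) = ((k + 2 : ℕ) : ℝ) * (1 / ((k : ℝ) + 2)) := by push_cast; field_simp
        _ ≤ _ := by gcongr
    rw [Nat.factorial_succ]
    push_cast
    calc ((k : ℝ) + 1) * k.factorial * Real.exp (k + 1)
        = (k + 1) * (k.factorial * Real.exp k) * Real.exp 1 := by rw [Real.exp_add]; ring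
      _ ≤ (k + 1) * ((k : ℝ) + 1) ^ (k + 1) * (((k : ℝ) + 2) / (k + 1)) ^ (k + 2) := by gcongr
      _ = ((k : ℝ) + 1 + 1) ^ (k + 1 + 1) := by
        rw [div_pow]
        field_simp
        ring

/-- The binomial probability `ℙ(Bin(N, p) = k)`. -/
def binomWeight (N k : ℕ) (p : ℝ) : ℝ := N.choose k * (p ^ k * (1 - p) ^ (N - k))

theorem binomWeight_pos {N k : ℕ} {p : ℝ} (hk : k ≤ N) (hp0 : k = 0 ∨ 0 < p) (hp1 : p < 1) :
    0 < binomWeight N k p := by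
  have h1 : (0 : ℝ) < N.choose k := by exact_mod_cast Nat.choose_pos hk
  have h2 : 0 < p ^ k := by
    rcases hp0 with rfl | h
    · simp
    · positivity
  have h3 : 0 < 1 - p := by linarith
  unfold binomWeight
  positivity

/-- A Stirling-type lower bound for the logarithm of a binomial probability. -/
def logBinomBound (N k : ℕ) (p : ℝ) : ℝ :=
  k * Real.log (((N : ℝ) + 1 - k) * p / (k + 1)) + k - Real.log (k + 1)
    + ((N : ℝ) - k) * Real.log (1 - p)

theorem logBinomBound_le_log {N k : ℕ} {p : ℝ} (hk : k ≤ N) (hp0 : k = 0 ∨ 0 < p)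
    (hp1 : p < 1) : logBinomBound N k p ≤ Real.log (binomWeight N k p) := by
  have h3 : 0 < 1 - p := by linarith
  have hkR : (k : ℝ) ≤ N := by exact_mod_cast hk
  have hN : (0 : ℝ) < (N : ℝ) + 1 - k := by linarith
  have hchoose : k * Real.log ((N : ℝ) + 1 - k) + k - (k + 1) * Real.log (k + 1)
      ≤ Real.log (N.choose k) := by
    have hdesc : ((N : ℝ) + 1 - k) ^ k ≤ (k.factorial : ℝ) * N.choose k := by
      have h := Nat.pow_sub_le_descFactorial N k
      rw [Nat.descFactorial_eq_factorial_mul_choose] at h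
      have h' : (((N + 1 - k : ℕ) : ℝ)) ^ k ≤ (k.factorial : ℝ) * N.choose k := by
        exact_mod_cast h
      rwa [Nat.cast_sub (by omega), Nat.cast_add, Nat.cast_one] at h'
    have hcp : (0 : ℝ) < N.choose k := by exact_mod_cast Nat.choose_pos hk
    have hfac : (0 : ℝ) < k.factorial := by exact_mod_cast Nat.factorial_pos k
    have e1 := Real.log_le_log (by positivity) hdesc
    have e2 := Real.log_le_log (by positivity) (factorial_mul_exp_le k)
    rw [Real.log_mul hfac.ne' hcp.ne', Real.log_pow] at e1
    rw [Real.log_mul hfac.ne' (Real.exp_pos _).ne', Real.log_exp, Real.log_pow] at e2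
    push_cast at e2
    linarith
  have hcp : (0 : ℝ) < N.choose k := by exact_mod_cast Nat.choose_pos hk
  unfold logBinomBound binomWeight
  rcases hp0 with rfl | hp
  · simp
  · rw [Real.log_mul hcp.ne' (by positivity), Real.log_mul (by positivity) (by positivity),
      Real.log_pow, Real.log_pow, Nat.cast_sub hk, Real.log_div (by positivity) (by positivity),
      Real.log_mul hN.ne' hp.ne']
    linarith

theorem tendsto_log_one_sub_div {p a : ℕ → ℝ} {c : ℝ} (ha : ∀ n, 0 < a n)
    (ha0 : Tendsto a atTop (nhds 0)) (hp : Tendsto (fun n => p n / a n) atTop (nhds c)) :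
    Tendsto (fun n => Real.log (1 - p n) / a n) atTop (nhds (-c)) := by
  have hp0 : Tendsto p atTop (nhds 0) := by
    have := hp.mul ha0
    rw [mul_zero] at this
    refine this.congr fun n => ?_
    have := (ha n).ne'
    field_simp
  have hd : HasDerivAt (fun x : ℝ => Real.log (1 - x)) (-1) 0 := by
    have := ((hasDerivAt_id (0 : ℝ)).const_sub 1).log (by simp)
    simpa using this
  have hs : Tendsto (dslope (fun x : ℝ => Real.log (1 - x)) 0) (nhds 0) (nhds (-1)) := by
    have := (continuousAt_dslope_same.2 hd.differentiableAt)
    have h := this.tendsto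
    rwa [dslope_same, hd.deriv] at h
  have := (hs.comp hp0).mul hp
  rw [neg_one_mul] at this
  refine this.congr fun n => ?_
  have h := sub_smul_dslope (fun x : ℝ => Real.log (1 - x)) 0 (p n)
  simp only [sub_zero, Real.log_one, smul_eq_mul] at h
  rw [← h]
  simp only [Function.comp]
  ring

variable {a : ℕ → ℝ}

theorem tendsto_speed (hna : Tendsto (fun n : ℕ => (n : ℝ) * a n) atTop atTop) :
    Tendsto (fun n : ℕ => a n * (n : ℝ) ^ 2) atTop atTop := by
  have := hna.atTop_mul_atTop₀ tendsto_natCast_atTop_atTop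
  refine this.congr fun n => ?_
  ring

theorem tendsto_logBinomBound {N k : ℕ → ℕ} {p : ℕ → ℝ} {κ ν c : ℝ}
    (ha : ∀ n, 0 < a n) (ha0 : Tendsto a atTop (nhds 0))
    (hna : Tendsto (fun n : ℕ => (n : ℝ) * a n) atTop atTop)
    (hN : Tendsto (fun n => (N n : ℝ) / (n : ℝ) ^ 2) atTop (nhds ν))
    (hk : ∀ n, k n = ⌊κ * (a n * (n : ℝ) ^ 2)⌋₊)
    (hp : Tendsto (fun n => p n / a n) atTop (nhds c))
    (hκ : 0 ≤ κ) (hν : 0 ≤ ν) (hc : 0 ≤ c) (hac : ν * c = 0 → κ = 0) :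
    (∀ᶠ n in atTop, k n ≤ N n ∧ (k n = 0 ∨ 0 < p n) ∧ p n < 1) ∧
    Tendsto (fun n : ℕ => logBinomBound (N n) (k n) (p n) / (a n * (n : ℝ) ^ 2)) atTop
      (nhds (-(κ * Real.log (κ / (ν * c))) + κ - ν * c)) := by
  have hm := tendsto_speed hna
  have hn0 : ∀ᶠ n : ℕ in atTop, (n : ℝ) ≠ 0 := by
    filter_upwards [eventually_gt_atTop 0] with n hn
    exact_mod_cast hn.ne'
  have hp0 : Tendsto p atTop (nhds 0) := by
    have := hp.mul ha0
    rw [mul_zero] at this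
    refine this.congr fun n => ?_
    have := (ha n).ne'
    field_simp
  have hp1 : ∀ᶠ n in atTop, p n < 1 := hp0.eventually (gt_mem_nhds one_pos)
  have hlog1 := tendsto_log_one_sub_div ha ha0 hp
  rcases hκ.eq_or_lt with h0 | hκ
  · subst h0
    have hk0 : ∀ n, k n = 0 := fun n => by simp [hk]
    refine ⟨?_, ?_⟩
    · filter_upwards [hp1] with n h
      exact ⟨by simp [hk0], Or.inl (hk0 n), h⟩
    · have := hN.mul hlog1
      have e : -((0 : ℝ) * Real.log (0 / (ν * c))) + 0 - ν * c = ν * -c := by ring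
      rw [e]
      refine this.congr fun n => ?_
      simp only [logBinomBound, hk0, Nat.cast_zero]
      simp only [zero_mul, zero_add, Real.log_one, sub_zero]
      rw [mul_comm (a n), mul_div_mul_comm]
  · have hνc : 0 < ν * c := lt_of_le_of_ne (mul_nonneg hν hc) fun h => hκ.ne' (hac h.symm)
    have hν : 0 < ν := pos_of_mul_pos_left hνc hc
    have hc : 0 < c := pos_of_mul_pos_right hνc hν.le
    have hkm : Tendsto (fun n : ℕ => (k n : ℝ) / (a n * (n : ℝ) ^ 2)) atTop (nhds κ) := by
      refine ((tendsto_nat_floor_mul_div_atTop hκ.le).comp hm).congr fun n => ?_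
      simp [hk]
    have hkn : Tendsto (fun n : ℕ => (k n : ℝ) / (n : ℝ) ^ 2) atTop (nhds 0) := by
      have := hkm.mul ha0
      rw [mul_zero] at this
      refine this.congr fun n => ?_
      have := (ha n).ne'
      rw [div_mul_eq_mul_div, mul_comm (a n), mul_div_mul_right _ _ this]
    have hinv : Tendsto (fun n : ℕ => 1 / (a n * (n : ℝ) ^ 2)) atTop (nhds 0) :=
      hm.inv_tendsto_atTop.congr fun n => (one_div _).symm
    have hinvn : Tendsto (fun n : ℕ => 1 / (n : ℝ) ^ 2) atTop (nhds 0) := by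
      have := hinv.mul ha0
      rw [mul_zero] at this
      refine this.congr fun n => ?_
      have := (ha n).ne'
      rw [div_mul_eq_mul_div, mul_comm (a n), mul_div_mul_right _ _ this]
    have hk1 : Tendsto (fun n : ℕ => ((k n : ℝ) + 1) / (a n * (n : ℝ) ^ 2)) atTop (nhds κ) := by
      have := hkm.add hinv
      rw [add_zero] at this
      exact this.congr fun n => (add_div _ _ _).symm
    have hkinf : Tendsto (fun n : ℕ => (k n : ℝ) + 1) atTop atTop := by
      refine tendsto_atTop_add_const_right _ _ ?_
      refine tendsto_natCast_atTop_atTop.comp ?_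
      have : k = fun n => ⌊κ * (a n * (n : ℝ) ^ 2)⌋₊ := funext hk
      rw [this]
      exact tendsto_nat_floor_atTop.comp (hm.const_mul_atTop hκ)
    have hlogk : Tendsto (fun n : ℕ => Real.log ((k n : ℝ) + 1) / (a n * (n : ℝ) ^ 2))
        atTop (nhds 0) := by
      have h1 : Tendsto (fun n : ℕ => Real.log ((k n : ℝ) + 1) / ((k n : ℝ) + 1)) atTop
          (nhds 0) := (Real.isLittleO_log_id_atTop.tendsto_div_nhds_zero).comp hkinf
      have := h1.mul hk1
      rw [zero_mul] at this
      refine this.congr fun n => ?_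
      have : (k n : ℝ) + 1 ≠ 0 := by positivity
      rw [div_mul_div_cancel₀ this]
    have hNk : Tendsto (fun n : ℕ => ((N n : ℝ) + 1 - k n) / (n : ℝ) ^ 2) atTop (nhds ν) := by
      have := (hN.add hinvn).sub hkn
      rw [add_zero, sub_zero] at this
      refine this.congr fun n => ?_
      rw [← add_div, ← sub_div]
    have hNk' : Tendsto (fun n : ℕ => ((N n : ℝ) - k n) / (n : ℝ) ^ 2) atTop (nhds ν) := by
      have := hN.sub hkn
      rw [sub_zero] at this
      exact this.congr fun n => (sub_div _ _ _).symm
    have harg : Tendsto (fun n : ℕ => ((N n : ℝ) + 1 - k n) * p n / (k n + 1)) atTop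
        (nhds (ν * c / κ)) := by
      refine ((hNk.mul hp).div hk1 hκ.ne').congr' ?_
      filter_upwards [hn0] with n hn
      have := (ha n).ne'
      have : (k n : ℝ) + 1 ≠ 0 := by positivity
      simp only [Pi.div_apply]
      field_simp
    have hlog := harg.log (div_pos hνc hκ).ne'
    refine ⟨?_, ?_⟩
    · filter_upwards [hp1, hp.eventually (lt_mem_nhds hc), hNk'.eventually (lt_mem_nhds hν)]
        with n h1 h2 h3
      refine ⟨?_, Or.inr ?_, h1⟩
      · by_contra! hlt
        have : (N n : ℝ) < k n := by exact_mod_cast hlt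
        have : ((N n : ℝ) - k n) / (n : ℝ) ^ 2 ≤ 0 :=
          div_nonpos_of_nonpos_of_nonneg (by linarith) (by positivity)
        linarith
      · have := mul_pos h2 (ha n)
        rwa [div_mul_cancel₀ _ (ha n).ne'] at this
    · have := (((hkm.mul hlog).add hkm).sub hlogk).add (hNk'.mul hlog1)
      have e : -(κ * Real.log (κ / (ν * c))) + κ - ν * c
          = κ * Real.log (ν * c / κ) + κ - 0 + ν * -c := by
        rw [← inv_div (ν * c) κ, Real.log_inv]
        ring
      rw [e]
      refine this.congr fun n => ?_
      unfold logBinomBound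
      rw [div_mul_div_comm, mul_comm ((n : ℝ) ^ 2) (a n)]
      ring

end Asymptotics

end CRG

namespace CRG

section Counting

/-- Edge sets with prescribed numbers of edges of each type. -/
def prescribed {ε τ : Type*} [DecidableEq τ] [Fintype τ] (E : Finset ε)
    (T : ε → τ) (k : τ → ℕ) : Finset (Finset ε) :=
  E.powerset.filter fun S => ∀ t, (S.filter (T · = t)).card = k t

variable {ε τ : Type*} [DecidableEq ε] [DecidableEq τ] [Fintype τ]

theorem prod_choose_le_card_prescribed (E : Finset ε) (T : ε → τ) (k : τ → ℕ) :
    ∏ t, (E.filter (T · = t)).card.choose (k t) ≤ (prescribed E T k).card := by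
  have hfib : ∀ A ∈ Fintype.piFinset fun t => (E.filter (T · = t)).powersetCard (k t),
      ∀ t, (Finset.univ.biUnion A).filter (T · = t) = A t := by
    intro A hA t
    simp only [Fintype.mem_piFinset, Finset.mem_powersetCard] at hA
    ext e
    simp only [Finset.mem_filter, Finset.mem_biUnion, Finset.mem_univ, true_and]
    constructor
    · rintro ⟨⟨s, hs⟩, rfl⟩
      have := (Finset.mem_filter.1 ((hA s).1 hs)).2
      rwa [this]
    · intro h
      exact ⟨⟨t, h⟩, (Finset.mem_filter.1 ((hA t).1 h)).2⟩
  have hcard : ∏ t, (E.filter (T · = t)).card.choose (k t)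
      = (Fintype.piFinset fun t => (E.filter (T · = t)).powersetCard (k t)).card := by
    simp [Fintype.card_piFinset, Finset.card_powersetCard]
  rw [hcard]
  refine Finset.card_le_card_of_injOn (fun A => Finset.univ.biUnion A) ?_ ?_
  · intro A hA
    have hA' := Finset.mem_coe.1 hA
    simp only [Fintype.mem_piFinset, Finset.mem_powersetCard] at hA'
    simp only [prescribed, Finset.coe_filter, Set.mem_ofPred_eq, Finset.mem_powerset]
    refine ⟨Finset.biUnion_subset.2 fun t _ => (hA' t).1.trans (Finset.filter_subset _ _), ?_⟩
    intro t
    rw [hfib A hA t]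
    exact (hA' t).2
  · intro A hA B hB h
    funext t
    rw [← hfib A hA t, ← hfib B hB t]
    exact congrArg (Finset.filter (T · = t)) h

theorem prod_ite_of_mem_prescribed {E S : Finset ε} {T : ε → τ} {k : τ → ℕ}
    (hS : S ∈ prescribed E T k) (f g : τ → ℝ) :
    ∏ e ∈ E, (if e ∈ S then f (T e) else g (T e))
      = ∏ t, (f t ^ k t * g t ^ ((E.filter (T · = t)).card - k t)) := by
  simp only [prescribed, Finset.mem_filter, Finset.mem_powerset] at hS
  obtain ⟨hSE, hk⟩ := hS
  rw [← Finset.prod_fiberwise E T]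
  refine Finset.prod_congr rfl fun t _ => ?_
  have h1 : (E.filter (T · = t)).filter (· ∈ S) = S.filter (T · = t) := by
    ext e
    simp only [Finset.mem_filter]
    exact ⟨fun h => ⟨h.2, h.1.2⟩, fun h => ⟨⟨hSE h.1, h.2⟩, h.1⟩⟩
  have hcard := Finset.card_filter_add_card_filter_not (s := E.filter (T · = t)) (· ∈ S)
  rw [h1, hk] at hcard
  calc ∏ e ∈ E.filter (T · = t), (if e ∈ S then f (T e) else g (T e))
      = ∏ e ∈ E.filter (T · = t), (if e ∈ S then f t else g t) :=
        Finset.prod_congr rfl fun e he => by rw [(Finset.mem_filter.1 he).2]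
    _ = _ := by
      rw [Finset.prod_ite, Finset.prod_const, Finset.prod_const, h1, hk]
      congr 2
      omega

end Counting

section Pairs

/-- The unordered colour type of a pair of vertices. -/
def edgeType {𝒳 : Type} {n : ℕ} (σ : Fin n → 𝒳) (e : Fin n × Fin n) : Sym2 𝒳 := s(σ e.1, σ e.2)

theorem edgeType_swap {𝒳 : Type} {n : ℕ} (σ : Fin n → 𝒳) (e : Fin n × Fin n) :
    edgeType σ e.swap = edgeType σ e := Sym2.eq_swap

variable {𝒳 : Type} [DecidableEq 𝒳]

/-- Half the number of ordered pairs representing an unordered pair. -/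
def diagFactor (t : Sym2 𝒳) : ℝ := if t.IsDiag then 1 / 2 else 1

theorem diagFactor_pos (t : Sym2 𝒳) : 0 < diagFactor t := by
  unfold diagFactor
  split_ifs <;> norm_num

theorem indicator_add_indicator_swap {n : ℕ} (σ : Fin n → 𝒳) (e : Fin n × Fin n) (b c : 𝒳) :
    (if (σ e.1, σ e.2) = (b, c) then (1 : ℝ) else 0)
      + (if (σ e.2, σ e.1) = (b, c) then (1 : ℝ) else 0)
      = if edgeType σ e = s(b, c) then (diagFactor s(b, c))⁻¹ else 0 := by
  simp only [diagFactor, edgeType, Sym2.mk_isDiag_iff, Sym2.eq_iff, Prod.mk.injEq]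
  generalize σ e.1 = x
  generalize σ e.2 = y
  by_cases h1 : x = b <;> by_cases h2 : y = c <;> by_cases h3 : x = c <;> by_cases h4 : y = b <;>
    by_cases h5 : b = c <;> (simp_all; try norm_num)

theorem sum_diagFactor_mul [Fintype 𝒳] (g : Sym2 𝒳 → ℝ) :
    ∑ t, diagFactor t * g t = 1 / 2 * ∑ q : 𝒳 × 𝒳, g s(q.1, q.2) := by
  rw [← Finset.sum_fiberwise Finset.univ (fun q : 𝒳 × 𝒳 => s(q.1, q.2)), Finset.mul_sum]
  refine Finset.sum_congr rfl fun t _ => ?_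
  induction t with
  | h a b =>
  have hg : ∀ q ∈ Finset.univ.filter (fun q : 𝒳 × 𝒳 => s(q.1, q.2) = s(a, b)),
      g s(q.1, q.2) = g s(a, b) := fun q hq => by rw [(Finset.mem_filter.1 hq).2]
  rw [Finset.sum_congr rfl hg, Finset.sum_const, nsmul_eq_mul]
  have hf : Finset.univ.filter (fun q : 𝒳 × 𝒳 => s(q.1, q.2) = s(a, b)) = {(a, b), (b, a)} := by
    ext ⟨x, y⟩
    simp
  rw [hf]
  by_cases h : a = b
  · subst h
    simp [diagFactor]
  · rw [Finset.card_pair (by simpa using fun h' _ => h h')]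
    simp [diagFactor, h]

/-- The number of vertices of a given colour. -/
def colourCount {n : ℕ} (σ : Fin n → 𝒳) (c : 𝒳) : ℕ := (Finset.univ.filter (σ · = c)).card

/-- The number of potential edges of a given unordered colour type. -/
def typeCount {n : ℕ} (σ : Fin n → 𝒳) (t : Sym2 𝒳) : ℕ :=
  ((Edges n).filter (edgeType σ · = t)).card

theorem typeCount_bounds {n : ℕ} (σ : Fin n → 𝒳) (b c : 𝒳) :
    (typeCount σ s(b, c) : ℝ) ≤ diagFactor s(b, c) * (colourCount σ b * colourCount σ c) ∧
    diagFactor s(b, c) * (colourCount σ b * colourCount σ c) - n ≤ typeCount σ s(b, c) := by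
  set P : Fin n × Fin n → ℝ := fun e => if edgeType σ e = s(b, c) then 1 else 0 with hP
  have hd := diagFactor_pos s(b, c)
  have hprod : ∀ b c : 𝒳, ∑ e : Fin n × Fin n, (if (σ e.1, σ e.2) = (b, c) then (1 : ℝ) else 0)
      = colourCount σ b * colourCount σ c := by
    intro b c
    rw [Finset.sum_boole, colourCount, colourCount, ← Nat.cast_mul, ← Finset.card_product]
    congr 2
    ext ⟨u, v⟩
    simp
  have htot : ∑ e, P e = 2 * (diagFactor s(b, c) * (colourCount σ b * colourCount σ c)) := by
    have h1 : ∀ e, P e = diagFactor s(b, c) * ((if (σ e.1, σ e.2) = (b, c) then (1 : ℝ) else 0)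
        + (if (σ e.1, σ e.2) = (c, b) then (1 : ℝ) else 0)) := by
      intro e
      have h2 : ((σ e.1, σ e.2) = (c, b)) ↔ ((σ e.2, σ e.1) = (b, c)) := by
        simp only [Prod.mk.injEq]
        tauto
      simp only [h2]
      rw [indicator_add_indicator_swap, mul_ite, mul_zero, mul_inv_cancel₀ hd.ne']
    simp only [h1]
    rw [← Finset.mul_sum, Finset.sum_add_distrib, hprod, hprod]
    ring
  have hlt : ∑ e ∈ Edges n, P e = typeCount σ s(b, c) := by
    rw [hP, Finset.sum_boole, typeCount]
  have hgt : ∑ e ∈ Finset.univ.filter (fun e : Fin n × Fin n => e.2 < e.1), P e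
      = typeCount σ s(b, c) := by
    rw [← hlt]
    refine Finset.sum_nbij' Prod.swap Prod.swap (by simp) (by simp) (by simp) (by simp) ?_
    intro e _
    simp only [hP, edgeType_swap]
  have hdiag0 : 0 ≤ ∑ e ∈ Finset.univ.filter (fun e : Fin n × Fin n => e.1 = e.2), P e :=
    Finset.sum_nonneg fun e _ => by simp only [hP]; split_ifs <;> norm_num
  have hdiag1 : ∑ e ∈ Finset.univ.filter (fun e : Fin n × Fin n => e.1 = e.2), P e ≤ n := by
    calc _ ≤ ∑ e ∈ Finset.univ.filter (fun e : Fin n × Fin n => e.1 = e.2), (1 : ℝ) :=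
          Finset.sum_le_sum fun e _ => by simp only [hP]; split_ifs <;> norm_num
      _ = n := by
        rw [Finset.sum_const, nsmul_eq_mul, mul_one]
        have : Finset.univ.filter (fun e : Fin n × Fin n => e.1 = e.2)
            = Finset.univ.diag := by ext; simp
        rw [this, Finset.diag_card, Finset.card_univ, Fintype.card_fin]
  have hsplit : ∑ e, P e = ∑ e ∈ Edges n, P e
      + ∑ e ∈ Finset.univ.filter (fun e : Fin n × Fin n => e.2 < e.1), P e
      + ∑ e ∈ Finset.univ.filter (fun e : Fin n × Fin n => e.1 = e.2), P e := by
    simp only [Finset.sum_filter, ← Finset.sum_add_distrib]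
    refine Finset.sum_congr rfl fun e _ => ?_
    rcases lt_trichotomy e.1 e.2 with h | h | h
    · simp [h, h.ne, h.not_gt]
    · simp [h]
    · simp [h, h.ne', h.not_gt]
  rw [htot, hlt, hgt] at hsplit
  constructor <;> linarith

theorem tendsto_typeCount {σ : ∀ n, Fin n → 𝒳} {b c : 𝒳} {ωb ωc : ℝ}
    (hb : Tendsto (fun n : ℕ => (colourCount (σ n) b : ℝ) / n) atTop (nhds ωb))
    (hc : Tendsto (fun n : ℕ => (colourCount (σ n) c : ℝ) / n) atTop (nhds ωc)) :
    Tendsto (fun n : ℕ => (typeCount (σ n) s(b, c) : ℝ) / (n : ℝ) ^ 2) atTop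
      (nhds (diagFactor s(b, c) * (ωb * ωc))) := by
  have h := (hb.mul hc).const_mul (diagFactor s(b, c))
  have h' := h.sub tendsto_one_div_atTop_nhds_zero_nat
  rw [sub_zero] at h'
  refine tendsto_of_tendsto_of_tendsto_of_le_of_le' h' h ?_ ?_
  · filter_upwards [eventually_gt_atTop 0] with n hn
    have hn : (0 : ℝ) < n := by exact_mod_cast hn
    have := (typeCount_bounds (σ n) b c).2
    rw [le_div_iff₀ (by positivity)]
    refine le_trans (le_of_eq ?_) this
    field_simp
  · filter_upwards [eventually_gt_atTop 0] with n hn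
    have hn : (0 : ℝ) < n := by exact_mod_cast hn
    have := (typeCount_bounds (σ n) b c).1
    rw [div_le_iff₀ (by positivity)]
    refine this.trans (le_of_eq ?_)
    field_simp

theorem exists_colouring [Fintype 𝒳] {n : ℕ} (m : 𝒳 → ℕ) (hm : ∑ c, m c = n) :
    ∃ σ : Fin n → 𝒳, ∀ c, colourCount σ c = m c := by
  have e : Fin n ≃ Σ c, Fin (m c) := Fintype.equivOfCardEq (by simp [hm])
  refine ⟨fun v => (e v).1, fun c => ?_⟩
  have h : (Finset.univ.filter fun v => (e v).1 = c).card = Fintype.card {v // (e v).1 = c} :=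
    (Fintype.card_subtype _).symm
  rw [colourCount, h, Fintype.card_congr (e.subtypeEquivOfSubtype (p := fun x => x.1 = c)),
    Fintype.card_congr (Equiv.sigmaSubtype c), Fintype.card_fin]

theorem exists_colouring_tendsto [Fintype 𝒳] [Nonempty 𝒳] {ω : 𝒳 → ℝ} (hω0 : ∀ c, 0 ≤ ω c)
    (hω1 : ∑ c, ω c = 1) :
    ∃ σ : ∀ n, Fin n → 𝒳,
      ∀ c, Tendsto (fun n : ℕ => (colourCount (σ n) c : ℝ) / n) atTop (nhds (ω c)) := by
  obtain ⟨c₀⟩ := ‹Nonempty 𝒳›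
  set f : ℕ → 𝒳 → ℕ := fun n c => ⌊ω c * (n : ℝ)⌋₊ with hf
  have hle : ∀ n, ∑ c, f n c ≤ n := by
    intro n
    have : (∑ c, (f n c : ℝ)) ≤ n := by
      calc (∑ c, (f n c : ℝ)) ≤ ∑ c, ω c * n :=
            Finset.sum_le_sum fun c _ =>
              Nat.floor_le (mul_nonneg (hω0 c) (Nat.cast_nonneg n))
        _ = n := by rw [← Finset.sum_mul, hω1, one_mul]
    exact_mod_cast this
  have hex : ∀ n, ∃ σ : Fin n → 𝒳, ∀ c, colourCount σ c
      = f n c + if c = c₀ then n - ∑ c, f n c else 0 := by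
    intro n
    refine exists_colouring _ ?_
    rw [Finset.sum_add_distrib, Finset.sum_ite_eq' Finset.univ c₀]
    simp only [Finset.mem_univ, if_true]
    have := hle n
    omega
  choose σ hσ using hex
  refine ⟨σ, fun c => ?_⟩
  have hfl : ∀ c, Tendsto (fun n : ℕ => (f n c : ℝ) / n) atTop (nhds (ω c)) := fun c =>
    (tendsto_nat_floor_mul_div_atTop (hω0 c)).comp tendsto_natCast_atTop_atTop
  have hrest : Tendsto (fun n : ℕ => ((n - ∑ c, f n c : ℕ) : ℝ) / n) atTop (nhds 0) := by
    have h := (tendsto_finsetSum Finset.univ fun c _ => hfl c).const_sub 1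
    rw [hω1, sub_self] at h
    refine h.congr' ?_
    filter_upwards [eventually_gt_atTop 0] with n hn
    have hn : (n : ℝ) ≠ 0 := by exact_mod_cast hn.ne'
    rw [Nat.cast_sub (hle n), Nat.cast_sum, sub_div, div_self hn, Finset.sum_div]
  by_cases hc : c = c₀
  · have := (hfl c).add hrest
    rw [add_zero] at this
    refine this.congr fun n => ?_
    rw [hσ, if_pos hc, Nat.cast_add, add_div]
  · refine (hfl c).congr fun n => ?_
    rw [hσ, if_neg hc, add_zero]

end Pairs

end CRG

namespace CRG

section Graph

theorem graphWeight_nonneg {𝒳 : Type} {μ : 𝒳 → ℝ} {p : 𝒳 → 𝒳 → ℝ} (hμ : ∀ c, 0 ≤ μ c)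
    (hp0 : ∀ b c, 0 ≤ p b c) (hp1 : ∀ b c, p b c ≤ 1) (n : ℕ)
    (x : (Fin n → 𝒳) × Finset (Fin n × Fin n)) : 0 ≤ graphWeight μ p n x := by
  unfold graphWeight
  refine mul_nonneg (mul_nonneg ?_ (Finset.prod_nonneg fun v _ => hμ _))
    (Finset.prod_nonneg fun e _ => ?_)
  · split_ifs <;> norm_num
  · split_ifs
    · exact hp0 _ _
    · exact sub_nonneg.2 (hp1 _ _)

theorem log_prod_colour_ge {𝒳 : Type} [Fintype 𝒳] {μ : 𝒳 → ℝ} (hμ0 : ∀ c, 0 < μ c)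
    (hμ1 : ∀ c, μ c ≤ 1) {n : ℕ} (σ : Fin n → 𝒳) :
    (n : ℝ) * ∑ c, Real.log (μ c) ≤ Real.log (∏ v, μ (σ v)) := by
  rw [Real.log_prod fun v _ => (hμ0 _).ne']
  calc (n : ℝ) * ∑ c, Real.log (μ c) = ∑ _v : Fin n, ∑ c, Real.log (μ c) := by simp
    _ ≤ _ := Finset.sum_le_sum fun v _ => by
      rw [← neg_le_neg_iff, ← Finset.sum_neg_distrib]
      exact Finset.single_le_sum (f := fun c => -Real.log (μ c))
        (fun c _ => neg_nonneg.2 (Real.log_nonpos (hμ0 c).le (hμ1 c))) (Finset.mem_univ (σ v))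

variable {𝒳 : Type} [Fintype 𝒳] [DecidableEq 𝒳]

theorem prod_binomWeight_le_graphPr {μ : 𝒳 → ℝ} {p : 𝒳 → 𝒳 → ℝ} (hμ : ∀ c, 0 ≤ μ c)
    (hp0 : ∀ b c, 0 ≤ p b c) (hp1 : ∀ b c, p b c ≤ 1) {pt : Sym2 𝒳 → ℝ}
    (hpt : ∀ b c, p b c = pt s(b, c)) {n : ℕ} (σ : Fin n → 𝒳) (k : Sym2 𝒳 → ℕ)
    {A : Set ((Fin n → 𝒳) × Finset (Fin n × Fin n))}
    (hA : ∀ S ∈ prescribed (Edges n) (edgeType σ) k, (σ, S) ∈ A) :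
    (∏ v, μ (σ v)) * ∏ t, binomWeight (typeCount σ t) (k t) (pt t) ≤ graphPr μ p n A := by
  set w : ℝ := (∏ v, μ (σ v)) *
    ∏ t, (pt t ^ k t * (1 - pt t) ^ (typeCount σ t - k t)) with hw
  have hw0 : 0 ≤ w := by
    refine mul_nonneg (Finset.prod_nonneg fun v _ => hμ _) (Finset.prod_nonneg fun t _ => ?_)
    induction t with
    | h b c =>
    rw [← hpt]
    exact mul_nonneg (pow_nonneg (hp0 _ _) _) (pow_nonneg (sub_nonneg.2 (hp1 _ _)) _)
  have hweight : ∀ S ∈ prescribed (Edges n) (edgeType σ) k, graphWeight μ p n (σ, S) = w := by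
    intro S hS
    have hsub : S ⊆ Edges n := by
      simp only [prescribed, Finset.mem_filter, Finset.mem_powerset] at hS
      exact hS.1
    have hprod := prod_ite_of_mem_prescribed hS pt fun t => 1 - pt t
    simp only [graphWeight, hsub, if_true, one_mul, hpt]
    rw [hw]
    congr 1
  calc (∏ v, μ (σ v)) * ∏ t, binomWeight (typeCount σ t) (k t) (pt t)
      = ((∏ t, ((Edges n).filter (edgeType σ · = t)).card.choose (k t) : ℕ) : ℝ) * w := by
        simp only [binomWeight, Finset.prod_mul_distrib, hw, Nat.cast_prod, typeCount]
        ring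
    _ ≤ ((prescribed (Edges n) (edgeType σ) k).card : ℝ) * w := by
        gcongr
        exact prod_choose_le_card_prescribed _ _ _
    _ = ∑ S ∈ prescribed (Edges n) (edgeType σ) k, A.indicator (graphWeight μ p n) (σ, S) := by
        rw [← nsmul_eq_mul, ← Finset.sum_const]
        refine Finset.sum_congr rfl fun S hS => ?_
        rw [Set.indicator_of_mem (hA S hS), hweight S hS]
    _ ≤ ∑ S, A.indicator (graphWeight μ p n) (σ, S) :=
        Finset.sum_le_univ_sum_of_nonneg fun S =>
          Set.indicator_nonneg (fun x _ => graphWeight_nonneg hμ hp0 hp1 n x) _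
    _ ≤ graphPr μ p n A := by
        rw [graphPr, Fintype.sum_prod_type]
        exact Finset.single_le_sum
          (f := fun σ => ∑ S, A.indicator (graphWeight μ p n) (σ, S))
          (fun σ _ => Finset.sum_nonneg fun S _ =>
            Set.indicator_nonneg (fun x _ => graphWeight_nonneg hμ hp0 hp1 n x) _)
          (Finset.mem_univ σ)

theorem L2_of_mem_prescribed {n : ℕ} {σ : Fin n → 𝒳} {k : Sym2 𝒳 → ℕ}
    {S : Finset (Fin n × Fin n)} (hS : S ∈ prescribed (Edges n) (edgeType σ) k) (an : ℝ)
    (b c : 𝒳) :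
    L2 an n (σ, S) (b, c)
      = (diagFactor s(b, c))⁻¹ * ((k s(b, c) : ℝ) / (an * (n : ℝ) ^ 2)) := by
  simp only [prescribed, Finset.mem_filter] at hS
  rw [L2]
  simp only [indicator_add_indicator_swap]
  rw [← Finset.sum_filter, Finset.sum_const, nsmul_eq_mul, hS.2]
  ring

theorem mem_MSpace {an : ℝ} (han : 0 < an) {n : ℕ} (hn : 0 < n)
    (x : (Fin n → 𝒳) × Finset (Fin n × Fin n)) : (L1 n x, L2 an n x) ∈ MSpace 𝒳 := by
  have hn' : (n : ℝ) ≠ 0 := by exact_mod_cast hn.ne'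
  refine ⟨fun c => ?_, ?_, fun q => ?_, fun b c => ?_⟩
  · simp only [L1]
    positivity
  · simp only [L1]
    rw [← Finset.sum_div, ← Nat.cast_sum,
      ← Finset.card_eq_sum_card_fiberwise (fun _ _ => Finset.mem_univ _)]
    simp [hn']
  · refine div_nonneg (Finset.sum_nonneg fun e _ => ?_) (by positivity)
    split_ifs <;> norm_num
  · simp only [L2]
    congr 1
    refine Finset.sum_congr rfl fun e _ => ?_
    rw [indicator_add_indicator_swap, indicator_add_indicator_swap, Sym2.eq_swap (a := b)]

/-- The lower bound for a single point of the effective domain of the rate function. -/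
theorem le_liminf_log_graphPr [Nonempty 𝒳]
    {μ : 𝒳 → ℝ} (hμ0 : ∀ c, 0 < μ c) (hμ1 : ∀ c, μ c ≤ 1)
    {p : ℕ → 𝒳 → 𝒳 → ℝ} (hp0 : ∀ n b c, 0 ≤ p n b c) (hp1 : ∀ n b c, p n b c ≤ 1)
    (hpsymm : ∀ n b c, p n b c = p n c b)
    {C : 𝒳 → 𝒳 → ℝ} (hC0 : ∀ b c, 0 ≤ C b c) (hCsymm : ∀ b c, C b c = C c b)
    {a : ℕ → ℝ} (hapos : ∀ n, 0 < a n)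
    (hconv : ∀ i j, Tendsto (fun n => p n i j / a n) atTop (nhds (C i j)))
    (ha0 : Tendsto a atTop (nhds 0))
    (hna : Tendsto (fun n : ℕ => (n : ℝ) * a n) atTop atTop)
    {U : Set ((𝒳 → ℝ) × (𝒳 × 𝒳 → ℝ))} (hU : IsOpen U)
    {ω : 𝒳 → ℝ} {ϖ : 𝒳 × 𝒳 → ℝ} (hz : (ω, ϖ) ∈ U) (hM : (ω, ϖ) ∈ MSpace 𝒳)
    (hac : ∀ q : 𝒳 × 𝒳, C q.1 q.2 * ω q.1 * ω q.2 = 0 → ϖ q = 0) :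
    ((-(1 / 2 * ((∑ q : 𝒳 × 𝒳, ϖ q * Real.log (ϖ q / (C q.1 q.2 * ω q.1 * ω q.2)))
      + (∑ q : 𝒳 × 𝒳, C q.1 q.2 * ω q.1 * ω q.2) - ∑ q : 𝒳 × 𝒳, ϖ q)) : ℝ) : EReal)
      ≤ liminf (fun n : ℕ => ((1 / (a n * (n : ℝ) ^ 2) : ℝ) : EReal) *
          elog (graphPr μ (p n) n {x | (L1 n x, L2 (a n) n x) ∈ U ∩ MSpace 𝒳})) atTop := by
  obtain ⟨hω0, hω1, hϖ0, hϖs⟩ := hM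
  simp only at hω0 hω1 hϖ0 hϖs
  obtain ⟨σ, hσ⟩ := exists_colouring_tendsto hω0 hω1
  set pt : ℕ → Sym2 𝒳 → ℝ := fun n => Sym2.lift ⟨p n, hpsymm n⟩
  set Ct : Sym2 𝒳 → ℝ := Sym2.lift ⟨C, hCsymm⟩
  set ϖt : Sym2 𝒳 → ℝ := Sym2.lift ⟨fun b c => ϖ (b, c), hϖs⟩
  set ωt : Sym2 𝒳 → ℝ := Sym2.lift ⟨fun b c => ω b * ω c, fun b c => mul_comm _ _⟩
  set k : ℕ → Sym2 𝒳 → ℕ := fun n t => ⌊diagFactor t * ϖt t * (a n * (n : ℝ) ^ 2)⌋₊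
  have hm := tendsto_speed hna
  have hpt : ∀ n b c, p n b c = pt n s(b, c) := fun n b c => rfl
  have hϖt0 : ∀ t, 0 ≤ ϖt t := fun t => Sym2.inductionOn t fun b c => hϖ0 (b, c)
  have hωt0 : ∀ t, 0 ≤ ωt t := fun t =>
    Sym2.inductionOn t fun b c => mul_nonneg (hω0 b) (hω0 c)
  have hCt0 : ∀ t, 0 ≤ Ct t := fun t => Sym2.inductionOn t fun b c => hC0 b c
  have hconvt : ∀ t, Tendsto (fun n => pt n t / a n) atTop (nhds (Ct t)) := fun t =>
    Sym2.inductionOn t fun b c => hconv b c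
  have hNt : ∀ t, Tendsto (fun n : ℕ => (typeCount (σ n) t : ℝ) / (n : ℝ) ^ 2) atTop
      (nhds (diagFactor t * ωt t)) := fun t =>
    Sym2.inductionOn t fun b c => tendsto_typeCount (hσ b) (hσ c)
  have hact : ∀ t, diagFactor t * ωt t * Ct t = 0 → diagFactor t * ϖt t = 0 := by
    intro t
    induction t with
    | h b c =>
    intro h
    rw [mul_assoc, mul_eq_zero, or_iff_right (diagFactor_pos _).ne'] at h
    have : ϖ (b, c) = 0 := hac (b, c) (by rw [← h]; simp only [ωt, Ct, Sym2.lift_mk]; ring)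
    simp only [ϖt, Sym2.lift_mk, this, mul_zero]
  have hbin := fun t => tendsto_logBinomBound (k := fun n => k n t) hapos ha0 hna (hNt t)
    (fun n => rfl) (hconvt t) (mul_nonneg (diagFactor_pos t).le (hϖt0 t))
    (mul_nonneg (diagFactor_pos t).le (hωt0 t)) (hCt0 t) (hact t)
  have hkt : ∀ t, Tendsto (fun n : ℕ => (k n t : ℝ) / (a n * (n : ℝ) ^ 2)) atTop
      (nhds (diagFactor t * ϖt t)) := fun t =>
    (tendsto_nat_floor_mul_div_atTop
      (mul_nonneg (diagFactor_pos t).le (hϖt0 t))).comp hm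
  have hemp : Tendsto (fun n : ℕ => ((fun c => (colourCount (σ n) c : ℝ) / n : 𝒳 → ℝ),
      (fun q => (diagFactor s(q.1, q.2))⁻¹ * ((k n s(q.1, q.2) : ℝ) / (a n * (n : ℝ) ^ 2)) :
        𝒳 × 𝒳 → ℝ))) atTop (nhds (ω, ϖ)) := by
    refine (tendsto_pi_nhds.2 hσ).prodMk_nhds (tendsto_pi_nhds.2 fun q => ?_)
    have h := (hkt s(q.1, q.2)).const_mul (diagFactor s(q.1, q.2))⁻¹
    rwa [inv_mul_cancel_left₀ (diagFactor_pos _).ne'] at h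
  set g : ℕ → ℝ := fun n => ((n : ℝ) * ∑ c, Real.log (μ c)) / (a n * (n : ℝ) ^ 2)
    + ∑ t, logBinomBound (typeCount (σ n) t) (k n t) (pt n t) / (a n * (n : ℝ) ^ 2) with hg
  have hcol : Tendsto (fun n : ℕ => ((n : ℝ) * ∑ c, Real.log (μ c)) / (a n * (n : ℝ) ^ 2))
      atTop (nhds 0) := by
    have h := hna.inv_tendsto_atTop.mul_const (∑ c, Real.log (μ c))
    rw [zero_mul] at h
    refine h.congr' ?_
    filter_upwards [eventually_gt_atTop 0] with n hn
    have hn : (n : ℝ) ≠ 0 := by exact_mod_cast hn.ne'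
    have := (hapos n).ne'
    simp only [Pi.inv_apply]
    field_simp
  have hglim := hcol.add (tendsto_finsetSum Finset.univ fun t _ => (hbin t).2)
  have hlim : (0 : ℝ) + ∑ t, (-(diagFactor t * ϖt t *
        Real.log (diagFactor t * ϖt t / (diagFactor t * ωt t * Ct t)))
        + diagFactor t * ϖt t - diagFactor t * ωt t * Ct t)
      = -(1 / 2 * ((∑ q : 𝒳 × 𝒳, ϖ q * Real.log (ϖ q / (C q.1 q.2 * ω q.1 * ω q.2)))
      + (∑ q : 𝒳 × 𝒳, C q.1 q.2 * ω q.1 * ω q.2) - ∑ q : 𝒳 × 𝒳, ϖ q)) := by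
    have h1 : ∀ t, -(diagFactor t * ϖt t *
        Real.log (diagFactor t * ϖt t / (diagFactor t * ωt t * Ct t)))
        + diagFactor t * ϖt t - diagFactor t * ωt t * Ct t
        = diagFactor t * (-(ϖt t * Real.log (ϖt t / (ωt t * Ct t))) + ϖt t - ωt t * Ct t) := by
      intro t
      rw [mul_assoc _ (ωt t), mul_div_mul_left _ _ (diagFactor_pos t).ne']
      ring
    simp only [h1]
    rw [sum_diagFactor_mul, zero_add, ← mul_neg, ← Finset.sum_add_distrib,
      ← Finset.sum_sub_distrib, ← Finset.sum_neg_distrib]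
    congr 1
    refine Finset.sum_congr rfl fun q _ => ?_
    simp only [ϖt, ωt, Ct, Sym2.lift_mk]
    rw [mul_comm (ω q.1 * ω q.2), ← mul_assoc]
    ring
  rw [hlim] at hglim
  have hgE : Tendsto (fun n => ((g n : ℝ) : EReal)) atTop _ :=
    (continuous_coe_real_ereal.tendsto _).comp hglim
  rw [← hgE.liminf_eq]
  refine liminf_le_liminf ?_
  filter_upwards [hemp.eventually_mem (hU.mem_nhds hz), eventually_gt_atTop 0,
    eventually_all.2 fun t => (hbin t).1] with n hn hn0 hfeas
  have hmpos : 0 < a n * (n : ℝ) ^ 2 := by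
    have : (0 : ℝ) < n := by exact_mod_cast hn0
    have := hapos n
    positivity
  have hle := prod_binomWeight_le_graphPr (fun c => (hμ0 c).le) (hp0 n) (hp1 n) (hpt n) (σ n)
    (k n) (A := {x | (L1 n x, L2 (a n) n x) ∈ U ∩ MSpace 𝒳}) (by
      intro S hS
      refine ⟨?_, mem_MSpace (hapos n) hn0 _⟩
      have hL2 : L2 (a n) n (σ n, S) = fun q => (diagFactor s(q.1, q.2))⁻¹ *
          ((k n s(q.1, q.2) : ℝ) / (a n * (n : ℝ) ^ 2)) :=
        funext fun q => L2_of_mem_prescribed hS (a n) q.1 q.2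
      rw [hL2]
      exact hn)
  have hbpos : ∀ t, 0 < binomWeight (typeCount (σ n) t) (k n t) (pt n t) := fun t =>
    binomWeight_pos (hfeas t).1 (hfeas t).2.1 (hfeas t).2.2
  have hμpos : 0 < ∏ v, μ (σ n v) := Finset.prod_pos fun v _ => hμ0 _
  have hprodpos : 0 < ∏ t, binomWeight (typeCount (σ n) t) (k n t) (pt n t) :=
    Finset.prod_pos fun t _ => hbpos t
  have hpos := (mul_pos hμpos hprodpos).trans_le hle
  rw [elog, if_neg hpos.not_ge, ← EReal.coe_mul, EReal.coe_le_coe_iff]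
  have hlog := Real.log_le_log (mul_pos hμpos hprodpos) hle
  rw [Real.log_mul hμpos.ne' hprodpos.ne', Real.log_prod fun t _ => (hbpos t).ne'] at hlog
  rw [hg, one_div, inv_mul_eq_div]
  simp only
  rw [← Finset.sum_div, ← add_div]
  refine div_le_div_of_nonneg_right (le_trans (add_le_add ?_ ?_) hlog) hmpos.le
  · exact log_prod_colour_ge hμ0 hμ1 (σ n)
  · exact Finset.sum_le_sum fun t _ =>
      logBinomBound_le_log (hfeas t).1 (hfeas t).2.1 (hfeas t).2.2

end Graph

end CRG

/-- **Lower bound in Theorem 2.4(i)** (Lemma 3.11): for the supercritical coloured random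
graph, for every open subset `O = U ∩ (ℳ(𝒳) × ℳ̃_*(𝒳×𝒳))` of the subspace,
`liminf (1/(aₙ n²)) log ℙ{(L¹,L²) ∈ O} ≥ −inf_O I₁`. -/
theorem lower_bound_speed_an_nsq_supercritical
    {𝒳 : Type} [Fintype 𝒳] [DecidableEq 𝒳] [Nonempty 𝒳]
    (μ : 𝒳 → ℝ) (hμ0 : ∀ a, 0 < μ a) (hμ1 : ∀ a, μ a ≤ 1) (hμs : ∑ a, μ a = 1)
    (p : ℕ → 𝒳 → 𝒳 → ℝ) (hp0 : ∀ n a b, 0 ≤ p n a b) (hp1 : ∀ n a b, p n a b ≤ 1)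
    (hpsymm : ∀ n a b, p n a b = p n b a)
    (C : 𝒳 → 𝒳 → ℝ) (hC0 : ∀ a b, 0 ≤ C a b) (hCsymm : ∀ a b, C a b = C b a)
    (a : ℕ → ℝ) (hapos : ∀ n, 0 < a n)
    (hconv : ∀ i j, Filter.Tendsto (fun n => p n i j / a n) Filter.atTop (nhds (C i j)))
    (ha0 : Filter.Tendsto a Filter.atTop (nhds 0))
    (hna : Filter.Tendsto (fun n : ℕ => (n : ℝ) * a n) Filter.atTop Filter.atTop)
    :
    ∀ U : Set ((𝒳 → ℝ) × (𝒳 × 𝒳 → ℝ)), IsOpen U →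
      - ⨅ z ∈ U ∩ MSpace 𝒳, (I1 C z : EReal)
        ≤ Filter.liminf (fun n : ℕ => ((1 / (a n * (n:ℝ)^2) : ℝ) : EReal) *
          elog (graphPr μ (p n) n {x | (L1 n x, L2 (a n) n x) ∈ U ∩ MSpace 𝒳})) Filter.atTop := by
  intro U hU
  rw [EReal.neg_le]
  refine le_iInf₂ fun z hz => ?_
  rw [EReal.neg_le]
  by_cases hac : ∀ q : 𝒳 × 𝒳, C q.1 q.2 * z.1 q.1 * z.1 q.2 = 0 → z.2 q = 0
  · refine le_trans ?_ (le_liminf_log_graphPr hμ0 hμ1 hp0 hp1 hpsymm hC0 hCsymm hapos hconv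
      ha0 hna hU (ω := z.1) (ϖ := z.2) hz.1 hz.2 hac)
    rw [EReal.coe_neg, EReal.neg_le_neg_iff, I1, hRel, if_pos hac]
    have h2 : (1 / 2 : ℝ≥0∞) = ENNReal.ofReal (1 / 2) := by
      rw [ENNReal.ofReal_div_of_pos two_pos, ENNReal.ofReal_one, ENNReal.ofReal_ofNat]
    rw [h2, ← ENNReal.ofReal_mul (by norm_num), EReal.coe_ennreal_ofReal]
    exact EReal.coe_le_coe_iff.2 (le_max_left _ _)
  · rw [I1, hRel, if_neg hac, ENNReal.mul_top (by simp)]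
    simp
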